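/- Let f : ℤ² → ℝ be finitely supported with Σ_{m ∈ ℤ²} f(m) = 0. Then the convolution u(m) = Σ_{n ∈ ℤ²} φ(m − n) f(n) decays at infinity: u(m) → 0 as |m| = √(m₁² + m₂²) → ∞. -/

import Mathlib

open Real MeasureTheory Filter

/-- The integrand of the lattice fundamental solution. -/
noncomputable def latticeKernel (m : ℤ × ℤ) (t : ℝ × ℝ) : ℝ :=
  (Real.cos (t.1 * (m.1 : ℝ) + t.2 * (m.2 : ℝ)) - 1) /
    (4 * Real.sin (t.1 / 2) ^ 2 + 4 * Real.sin (t.2 / 2) ^ 2)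

/-- The lattice fundamental solution `φ`. -/
noncomputable def phi (m : ℤ × ℤ) : ℝ :=
  (1 / (2 * Real.pi) ^ 2) *
    ∫ t in Set.Icc (-Real.pi) Real.pi ×ˢ Set.Icc (-Real.pi) Real.pi, latticeKernel m t

/-- The discrete Laplace operator on `ℤ²`. -/
noncomputable def discLap (u : ℤ × ℤ → ℝ) (m : ℤ × ℤ) : ℝ :=
  4 * u m - u (m + (1, 0)) - u (m - (1, 0)) - u (m + (0, 1)) - u (m - (0, 1))

/-- The Euclidean norm `|m| = √(m₁² + m₂²)` of a lattice point. -/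
noncomputable def latNorm (m : ℤ × ℤ) : ℝ :=
  Real.sqrt ((m.1 : ℝ) ^ 2 + (m.2 : ℝ) ^ 2)

/-- Convolution with the lattice fundamental solution: `[Sf](m) = Σₙ φ(m−n) f(n)`. -/
noncomputable def latConv (f : ℤ × ℤ → ℝ) (m : ℤ × ℤ) : ℝ :=
  ∑ᶠ n : ℤ × ℤ, phi (m - n) * f n

/-- The Fourier symbol of the discrete Laplace operator. -/
noncomputable def lapSymbol (t : ℝ × ℝ) : ℝ :=
  4 * Real.sin (t.1 / 2) ^ 2 + 4 * Real.sin (t.2 / 2) ^ 2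

/-- The square `[-π, π]²`. -/
def brillouinZone : Set (ℝ × ℝ) :=
  Set.Icc (-Real.pi) Real.pi ×ˢ Set.Icc (-Real.pi) Real.pi

/-- The pairing of a lattice point with a frequency. -/
noncomputable def latPhase (m : ℤ × ℤ) (t : ℝ × ℝ) : ℝ :=
  t.1 * (m.1 : ℝ) + t.2 * (m.2 : ℝ)

lemma latPhase_sub (m n : ℤ × ℤ) (t : ℝ × ℝ) :
    latPhase (m - n) t = latPhase m t - latPhase n t := by
  simp only [latPhase, Prod.fst_sub, Prod.snd_sub, Int.cast_sub]
  ring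

lemma latticeKernel_eq (m : ℤ × ℤ) (t : ℝ × ℝ) :
    latticeKernel m t = (Real.cos (latPhase m t) - 1) / lapSymbol t := rfl

lemma measurableSet_brillouinZone : MeasurableSet brillouinZone :=
  measurableSet_Icc.prod measurableSet_Icc

@[fun_prop]
lemma continuous_lapSymbol : Continuous lapSymbol := by
  unfold lapSymbol; fun_prop

@[fun_prop]
lemma continuous_latPhase (m : ℤ × ℤ) : Continuous (latPhase m) := by
  unfold latPhase; fun_prop

lemma sq_div_pi_sq_le_sin_half_sq {x : ℝ} (hx : x ∈ Set.Icc (-Real.pi) Real.pi) :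
    x ^ 2 / Real.pi ^ 2 ≤ Real.sin (x / 2) ^ 2 := by
  have habs : |x| ≤ Real.pi := abs_le.mpr hx
  have h := Real.mul_le_sin (x := |x| / 2) (by positivity) (by linarith)
  have h' : |x| / Real.pi ≤ Real.sin (|x| / 2) := by
    calc |x| / Real.pi = 2 / Real.pi * (|x| / 2) := by ring
      _ ≤ _ := h
  have hsq : Real.sin (|x| / 2) ^ 2 = Real.sin (x / 2) ^ 2 := by
    rcases abs_choice x with h | h <;> rw [h]
    rw [neg_div, Real.sin_neg, neg_sq]
  calc x ^ 2 / Real.pi ^ 2 = (|x| / Real.pi) ^ 2 := by rw [div_pow, sq_abs]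
    _ ≤ Real.sin (|x| / 2) ^ 2 := by gcongr
    _ = _ := hsq

lemma lapSymbol_lower_bound {t : ℝ × ℝ} (ht : t ∈ brillouinZone) :
    4 / Real.pi ^ 2 * (t.1 ^ 2 + t.2 ^ 2) ≤ lapSymbol t := by
  have h1 := sq_div_pi_sq_le_sin_half_sq ht.1
  have h2 := sq_div_pi_sq_le_sin_half_sq ht.2
  calc 4 / Real.pi ^ 2 * (t.1 ^ 2 + t.2 ^ 2)
      = 4 * (t.1 ^ 2 / Real.pi ^ 2) + 4 * (t.2 ^ 2 / Real.pi ^ 2) := by ring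
    _ ≤ lapSymbol t := by unfold lapSymbol; linarith

lemma lapSymbol_nonneg (t : ℝ × ℝ) : 0 ≤ lapSymbol t := by
  unfold lapSymbol; positivity

lemma integrableOn_latticeKernel (m : ℤ × ℤ) :
    IntegrableOn (latticeKernel m) brillouinZone := by
  have hfin : volume brillouinZone ≠ ⊤ :=
    (isCompact_Icc.prod isCompact_Icc).measure_lt_top.ne
  have hmeas : Measurable (latticeKernel m) := by
    unfold latticeKernel; fun_prop
  refine Measure.integrableOn_of_bounded
    (M := ((m.1 : ℝ) ^ 2 + (m.2 : ℝ) ^ 2) * Real.pi ^ 2 / 8) hfin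
    hmeas.aestronglyMeasurable ?_
  filter_upwards [ae_restrict_mem measurableSet_brillouinZone] with t ht
  have hlow := lapSymbol_lower_bound ht
  rw [latticeKernel_eq, norm_div, Real.norm_eq_abs, Real.norm_of_nonneg (lapSymbol_nonneg t)]
  refine div_le_of_le_mul₀ (lapSymbol_nonneg t) (by positivity) ?_
  have hcos := Real.one_sub_sq_div_two_le_cos (x := latPhase m t)
  have hle := Real.cos_le_one (latPhase m t)
  have hcs : latPhase m t ^ 2 ≤
      ((m.1 : ℝ) ^ 2 + (m.2 : ℝ) ^ 2) * (t.1 ^ 2 + t.2 ^ 2) := by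
    unfold latPhase
    nlinarith [sq_nonneg (t.1 * (m.2 : ℝ) - t.2 * (m.1 : ℝ))]
  rw [abs_of_nonpos (by linarith)]
  calc -(Real.cos (latPhase m t) - 1) ≤ latPhase m t ^ 2 / 2 := by linarith
    _ ≤ ((m.1 : ℝ) ^ 2 + (m.2 : ℝ) ^ 2) * (t.1 ^ 2 + t.2 ^ 2) / 2 := by gcongr
    _ = ((m.1 : ℝ) ^ 2 + (m.2 : ℝ) ^ 2) * Real.pi ^ 2 / 8 *
        (4 / Real.pi ^ 2 * (t.1 ^ 2 + t.2 ^ 2)) := by field_simp; ring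
    _ ≤ _ := by gcongr

lemma integrableOn_inv_sqrt_abs {c : ℝ} (hc : 0 ≤ c) :
    IntegrableOn (fun x : ℝ => (√|x|)⁻¹) (Set.Icc (-c) c) := by
  have hpos : IntervalIntegrable (fun x : ℝ => (√|x|)⁻¹) volume 0 c := by
    refine (intervalIntegral.intervalIntegrable_rpow' (r := -(1 / 2))
      (by norm_num)).congr fun x hx => ?_
    rw [Set.uIoc_of_le hc] at hx
    simp only [abs_of_pos hx.1, Real.sqrt_eq_rpow, Real.rpow_neg hx.1.le]
  have hneg : IntervalIntegrable (fun x : ℝ => (√|x|)⁻¹) volume (-c) 0 := by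
    simpa using ((IntervalIntegrable.iff_comp_neg).mp hpos).symm
  rw [integrableOn_Icc_iff_integrableOn_Ioc]
  exact (intervalIntegrable_iff_integrableOn_Ioc_of_le (by linarith)).mp (hneg.trans hpos)

lemma integrableOn_inv_sqrt_abs_mul :
    IntegrableOn (fun t : ℝ × ℝ => (√|t.1|)⁻¹ * (√|t.2|)⁻¹) brillouinZone := by
  have h := integrableOn_inv_sqrt_abs Real.pi_pos.le
  unfold IntegrableOn brillouinZone
  rw [Measure.volume_eq_prod, ← Measure.prod_restrict]
  exact Integrable.mul_prod h h

/-- The symbol of the difference between translation by `n` and the identity, divided by the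
symbol of the discrete Laplace operator. -/
noncomputable def translationSymbol (n : ℤ × ℤ) (t : ℝ × ℝ) : ℂ :=
  (Complex.exp (Complex.I * ((-latPhase n t : ℝ) : ℂ)) - 1) / (lapSymbol t : ℂ)

lemma abs_add_abs_le_of_ne_zero {x y : ℝ} (hx : x ≠ 0) (hy : y ≠ 0) :
    |x| + |y| ≤ 2 * ((√|x|)⁻¹ * (√|y|)⁻¹) * (x ^ 2 + y ^ 2) := by
  have ha : 0 < √|x| := by positivity
  have hb : 0 < √|y| := by positivity
  have hxa : |x| = √|x| ^ 2 := (Real.sq_sqrt (abs_nonneg x)).symm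
  have hyb : |y| = √|y| ^ 2 := (Real.sq_sqrt (abs_nonneg y)).symm
  rw [← sq_abs x, ← sq_abs y]
  set a := √|x|
  set b := √|y|
  rw [hxa, hyb]
  have hmul : (a ^ 2 + b ^ 2) * (a * b) ≤ 2 * ((a ^ 2) ^ 2 + (b ^ 2) ^ 2) := by
    nlinarith [mul_nonneg (add_nonneg (sq_nonneg a) (sq_nonneg b)) (sq_nonneg (a - b)),
      sq_nonneg (a ^ 2 - b ^ 2)]
  calc a ^ 2 + b ^ 2 = (a ^ 2 + b ^ 2) * (a * b) * (a⁻¹ * b⁻¹) := by field_simp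
    _ ≤ 2 * ((a ^ 2) ^ 2 + (b ^ 2) ^ 2) * (a⁻¹ * b⁻¹) := by gcongr
    _ = _ := by ring

lemma integrableOn_translationSymbol (n : ℤ × ℤ) :
    IntegrableOn (translationSymbol n) brillouinZone := by
  have hmeas : Measurable (translationSymbol n) := by
    unfold translationSymbol
    have := (continuous_latPhase n).measurable
    have := continuous_lapSymbol.measurable
    fun_prop
  have hne1 : ∀ᵐ t : ℝ × ℝ, t.1 ≠ 0 :=
    Measure.quasiMeasurePreserving_fst.ae (Measure.ae_ne volume 0)
  have hne2 : ∀ᵐ t : ℝ × ℝ, t.2 ≠ 0 :=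
    Measure.quasiMeasurePreserving_snd.ae (Measure.ae_ne volume 0)
  refine Integrable.mono' (integrableOn_inv_sqrt_abs_mul.const_mul
    ((|(n.1 : ℝ)| + |(n.2 : ℝ)|) * Real.pi ^ 2 / 2)) hmeas.aestronglyMeasurable ?_
  filter_upwards [ae_restrict_mem measurableSet_brillouinZone, ae_restrict_of_ae hne1,
    ae_restrict_of_ae hne2] with t ht h1 h2
  have hlow := lapSymbol_lower_bound ht
  have hexp := Real.norm_exp_I_mul_ofReal_sub_one_le (x := -latPhase n t)
  rw [translationSymbol, norm_div, Complex.norm_real, Real.norm_of_nonneg (lapSymbol_nonneg t)]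
  refine div_le_of_le_mul₀ (lapSymbol_nonneg t) (by positivity) ?_
  have hphase : |latPhase n t| ≤ (|(n.1 : ℝ)| + |(n.2 : ℝ)|) * (|t.1| + |t.2|) := by
    unfold latPhase
    have h := abs_add_le (t.1 * (n.1 : ℝ)) (t.2 * (n.2 : ℝ))
    rw [abs_mul, abs_mul] at h
    nlinarith [mul_nonneg (abs_nonneg t.1) (abs_nonneg (n.2 : ℝ)),
      mul_nonneg (abs_nonneg t.2) (abs_nonneg (n.1 : ℝ))]
  calc _ ≤ |latPhase n t| := by simpa using hexp
    _ ≤ (|(n.1 : ℝ)| + |(n.2 : ℝ)|) * (|t.1| + |t.2|) := hphase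
    _ ≤ (|(n.1 : ℝ)| + |(n.2 : ℝ)|) *
        (2 * ((√|t.1|)⁻¹ * (√|t.2|)⁻¹) * (t.1 ^ 2 + t.2 ^ 2)) := by
      gcongr; exact abs_add_abs_le_of_ne_zero h1 h2
    _ = (|(n.1 : ℝ)| + |(n.2 : ℝ)|) * Real.pi ^ 2 / 2 * ((√|t.1|)⁻¹ * (√|t.2|)⁻¹) *
        (4 / Real.pi ^ 2 * (t.1 ^ 2 + t.2 ^ 2)) := by field_simp; ring
    _ ≤ _ := by gcongr

/-- The functional on frequencies whose Fourier character is `t ↦ exp (i t · m)`. -/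
noncomputable def latDual (m : ℤ × ℤ) : StrongDual ℝ (ℝ × ℝ) :=
  (-(2 * Real.pi)⁻¹ : ℝ) • ((m.1 : ℝ) • ContinuousLinearMap.fst ℝ ℝ ℝ +
    (m.2 : ℝ) • ContinuousLinearMap.snd ℝ ℝ ℝ)

lemma latDual_apply (m : ℤ × ℤ) (t : ℝ × ℝ) :
    latDual m t = -(2 * Real.pi)⁻¹ * latPhase m t := by
  simp [latDual, latPhase]
  ring

lemma fourierChar_neg_latDual (m : ℤ × ℤ) (t : ℝ × ℝ) :
    (Real.fourierChar (-latDual m t) : ℂ) = Complex.exp (Complex.I * (latPhase m t : ℂ)) := by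
  rw [Real.fourierChar_apply, latDual_apply, mul_comm]
  congr 3
  field_simp

lemma latNorm_le_norm_latDual (m : ℤ × ℤ) :
    (2 * Real.pi)⁻¹ * latNorm m ≤ ‖latDual m‖ := by
  rcases (show 0 ≤ latNorm m from Real.sqrt_nonneg _).eq_or_lt with h | h
  · rw [← h]; simp
  have hsq : latNorm m ^ 2 = (m.1 : ℝ) ^ 2 + (m.2 : ℝ) ^ 2 := Real.sq_sqrt (by positivity)
  have hop := (latDual m).le_opNorm ((m.1 : ℝ), (m.2 : ℝ))
  have hval : ‖latDual m ((m.1 : ℝ), (m.2 : ℝ))‖ = (2 * Real.pi)⁻¹ * latNorm m ^ 2 := by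
    have : latPhase m ((m.1 : ℝ), (m.2 : ℝ)) = latNorm m ^ 2 := by
      rw [hsq]; simp only [latPhase]; ring
    rw [latDual_apply, this, norm_mul, norm_neg, Real.norm_of_nonneg (by positivity),
      Real.norm_of_nonneg (by positivity)]
  have hnorm : ‖((m.1 : ℝ), (m.2 : ℝ))‖ ≤ latNorm m := by
    refine max_le (Real.abs_le_sqrt ?_) (Real.abs_le_sqrt ?_) <;> simp only <;> nlinarith
  rw [hval] at hop
  refine le_of_mul_le_mul_right ?_ h
  calc (2 * Real.pi)⁻¹ * latNorm m * latNorm m = (2 * Real.pi)⁻¹ * latNorm m ^ 2 := by ring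
    _ ≤ _ := hop
    _ ≤ _ := by gcongr

lemma tendsto_latDual_cocompact :
    Tendsto latDual (comap latNorm atTop) (cocompact (StrongDual ℝ (ℝ × ℝ))) := by
  have : ProperSpace (StrongDual ℝ (ℝ × ℝ)) := FiniteDimensional.proper ℝ _
  rw [← Metric.cobounded_eq_cocompact, ← tendsto_norm_atTop_iff_cobounded]
  exact tendsto_atTop_mono latNorm_le_norm_latDual
    (tendsto_comap.const_mul_atTop (by positivity))

lemma latticeKernel_sub_sub (m n : ℤ × ℤ) (t : ℝ × ℝ) :
    latticeKernel (m - n) t - latticeKernel m t =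
      ((Real.fourierChar (-latDual m t) : ℂ) * translationSymbol n t).re := by
  have h : (Real.fourierChar (-latDual m t) : ℂ) * translationSymbol n t =
      (Complex.exp ((latPhase (m - n) t : ℝ) * Complex.I) -
        Complex.exp ((latPhase m t : ℝ) * Complex.I)) / (lapSymbol t : ℂ) := by
    rw [fourierChar_neg_latDual, translationSymbol, mul_div_assoc', mul_sub, mul_one,
      ← Complex.exp_add, ← mul_add, latPhase_sub]
    push_cast
    ring_nf
  rw [h, Complex.div_ofReal_re, Complex.sub_re, Complex.exp_ofReal_mul_I_re,
    Complex.exp_ofReal_mul_I_re, latticeKernel_eq, latticeKernel_eq, ← sub_div]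
  ring_nf

lemma phi_sub_sub (m n : ℤ × ℤ) :
    phi (m - n) - phi m = (1 / (2 * Real.pi) ^ 2) *
      (∫ t, Real.fourierChar (-latDual m t) •
        brillouinZone.indicator (translationSymbol n) t).re := by
  have hG : Integrable (brillouinZone.indicator (translationSymbol n)) :=
    (integrable_indicator_iff measurableSet_brillouinZone).mpr (integrableOn_translationSymbol n)
  have hchar : Continuous fun t => Real.fourierChar (-latDual m t) :=
    Real.continuous_fourierChar.comp (latDual m).continuous.neg
  have hint : Integrable fun t => Real.fourierChar (-latDual m t) •
      brillouinZone.indicator (translationSymbol n) t :=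
    hG.norm.mono' (hchar.aestronglyMeasurable.smul hG.aestronglyMeasurable)
      (.of_forall fun t => (Circle.norm_smul _ _).le)
  have hre : (∫ t, Real.fourierChar (-latDual m t) •
      brillouinZone.indicator (translationSymbol n) t).re =
      ∫ t in brillouinZone, (latticeKernel (m - n) t - latticeKernel m t) := by
    rw [← integral_indicator measurableSet_brillouinZone, ← RCLike.re_eq_complex_re,
      ← integral_re hint]
    refine integral_congr_ae (.of_forall fun t => ?_)
    by_cases ht : t ∈ brillouinZone
    · simp [ht, latticeKernel_sub_sub, Circle.smul_def]
    · simp [ht]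
  rw [hre, integral_sub (integrableOn_latticeKernel _) (integrableOn_latticeKernel _), mul_sub]
  rfl

lemma tendsto_phi_sub_sub (n : ℤ × ℤ) :
    Tendsto (fun m => phi (m - n) - phi m) (comap latNorm atTop) (nhds 0) := by
  have h := (tendsto_integral_exp_smul_cocompact
    (brillouinZone.indicator (translationSymbol n)) volume).comp tendsto_latDual_cocompact
  have h' := ((Complex.continuous_re.tendsto 0).comp h).const_mul (1 / (2 * Real.pi) ^ 2)
  simpa [phi_sub_sub, Function.comp_def] using h'

/-- If `f` is finitely supported with total charge zero, then the convolution
`u = φ * f` tends to `0` as `|m| → ∞`. -/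
theorem latConv_tendsto_zero (f : ℤ × ℤ → ℝ) (hf : (Function.support f).Finite)
    (hsum : ∑ᶠ m : ℤ × ℤ, f m = 0) :
    Filter.Tendsto (latConv f) (Filter.comap latNorm Filter.atTop) (nhds 0) := by
  have hconv : latConv f = fun m => ∑ n ∈ hf.toFinset, (phi (m - n) - phi m) * f n := by
    funext m
    have hsupp : (Function.support fun n => phi (m - n) * f n) ⊆ hf.toFinset := by
      intro n hn
      simpa using right_ne_zero_of_mul hn
    rw [finsum_eq_sum_of_support_subset f (s := hf.toFinset) (by simp)] at hsum
    rw [latConv, finsum_eq_sum_of_support_subset _ hsupp]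
    simp [sub_mul, Finset.sum_sub_distrib, ← Finset.mul_sum, hsum]
  rw [hconv, ← Finset.sum_const_zero (s := hf.toFinset) (ι := ℤ × ℤ)]
  refine tendsto_finsetSum _ fun n _ => ?_
  simpa using (tendsto_phi_sub_sub n).mul_const (f n)
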